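/- arXiv:2308.00460 — 5 statements merged into one kernel-verified Lean document; each statement's English description precedes it below -/
import Mathlib

section
/- For every λ > 0 and every t ≥ 0, the Laplace transform of the Lévy distribution with scale parameter λ satisfies ∫₀^∞ e^{−tx} · √(λ/(2π)) · e^{−λ/(2x)} · x^{−3/2} dx = e^{−√(2λt)}. -/
open MeasureTheory Set

/-- The density of the Lévy distribution with scale parameter `l`, for `x > 0`. -/
noncomputable def levyPDFpos (l x : ℝ) : ℝ :=
  Real.sqrt (l / (2 * Real.pi)) * Real.exp (-(l / (2 * x))) * x ^ (-(3:ℝ)/2)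

lemma hasDerivAt_mul_sub_div (a b : ℝ) {u : ℝ} (hu : u ≠ 0) :
    HasDerivAt (fun u : ℝ => a * u - b / u) (a + b / u ^ 2) u := by
  have h := ((hasDerivAt_id u).const_mul a).sub ((hasDerivAt_inv hu).const_mul b)
  have hval : a * 1 - b * -(u ^ 2)⁻¹ = a + b / u ^ 2 := by ring
  rwa [hval] at h

lemma injOn_mul_sub_div {a b : ℝ} (ha : 0 < a) (hb : 0 ≤ b) :
    InjOn (fun u : ℝ => a * u - b / u) (Ioi 0) := by
  intro x hx y hy hxy
  have hx' : 0 < x := hx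
  have hy' : 0 < y := hy
  have h : (x - y) * (a * (x * y) + b) = 0 := by
    simp only at hxy
    field_simp at hxy
    linarith
  rcases mul_eq_zero.mp h with h | h
  · linarith
  · have : 0 < a * (x * y) := by positivity
    linarith

lemma image_mul_sub_div_Ioi {a b : ℝ} (ha : 0 < a) (hb : 0 < b) :
    (fun u : ℝ => a * u - b / u) '' Ioi 0 = univ := by
  refine eq_univ_of_forall fun v => ?_
  obtain ⟨s, hs0, hs⟩ : ∃ s : ℝ, 0 ≤ s ∧ s ^ 2 = v ^ 2 + 4 * a * b :=
    ⟨_, Real.sqrt_nonneg _, Real.sq_sqrt (by positivity)⟩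
  have hlt : |v| < s := abs_lt_of_sq_lt_sq (by linarith [mul_pos ha hb]) hs0
  have hpos : 0 < v + s := by linarith [neg_abs_le v]
  refine ⟨(v + s) / (2 * a), div_pos hpos (by positivity), ?_⟩
  have hne := hpos.ne'
  simp only
  field_simp
  linear_combination hs

/-- The **Cauchy–Schlömilch transformation** for even functions. -/
lemma integral_comp_mul_sub_div_Ioi {g : ℝ → ℝ} (hg : Integrable g) (hgm : Measurable g)
    (heven : ∀ v, g (-v) = g v) {a b : ℝ} (ha : 0 < a) (hb : 0 < b) :
    ∫ u in Ioi (0 : ℝ), g (a * u - b / u) = (∫ v, g v) / (2 * a) := by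
  have hderiv : ∀ u ∈ Ioi (0 : ℝ),
      HasDerivWithinAt (fun u : ℝ => a * u - b / u) (a + b / u ^ 2) (Ioi 0) u :=
    fun u hu => (hasDerivAt_mul_sub_div a b (ne_of_gt hu)).hasDerivWithinAt
  have hinj := injOn_mul_sub_div ha hb.le
  have himage := image_mul_sub_div_Ioi ha hb
  have habs : ∀ u : ℝ, |a + b / u ^ 2| = a + b / u ^ 2 := fun u => abs_of_pos (by positivity)
  have hsum := integral_image_eq_integral_abs_deriv_smul measurableSet_Ioi hderiv hinj g
  have hint :=
    (integrableOn_image_iff_integrableOn_abs_deriv_smul measurableSet_Ioi hderiv hinj g).mp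
      (by rwa [himage, integrableOn_univ])
  simp only [himage, Measure.restrict_univ, habs, smul_eq_mul] at hsum hint
  have hint₁ : IntegrableOn (fun u : ℝ => a * g (a * u - b / u)) (Ioi 0) := by
    refine Integrable.mono hint (Measurable.aestronglyMeasurable (by fun_prop)) (.of_forall fun u => ?_)
    have h : 0 ≤ b / u ^ 2 := by positivity
    rw [norm_mul, norm_mul, Real.norm_of_nonneg ha.le, Real.norm_eq_abs (a + _), habs]
    exact mul_le_mul_of_nonneg_right (by linarith) (norm_nonneg _)
  have hint₂ : IntegrableOn (fun u : ℝ => b / u ^ 2 * g (a * u - b / u)) (Ioi 0) :=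
    (hint.sub hint₁).congr (.of_forall fun u => by simp only [Pi.sub_apply]; ring)
  have hinv : ∫ u in Ioi (0 : ℝ), g (a * u - b / u)
      = ∫ u in Ioi (0 : ℝ), b / a / u ^ 2 * g (a * u - b / u) := by
    have hc : 0 < b / a := by positivity
    have himage' : (fun u : ℝ => b / a / u) '' Ioi 0 = Ioi 0 := by
      ext v
      constructor
      · rintro ⟨u, hu, rfl⟩
        exact div_pos hc hu
      · intro hv
        have hv' : 0 < v := hv
        exact ⟨b / a / v, div_pos hc hv, by field_simp⟩
    have hinj' : InjOn (fun u : ℝ => b / a / u) (Ioi 0) := by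
      intro x hx y hy hxy
      have hx' : 0 < x := hx
      have hy' : 0 < y := hy
      simp only at hxy
      field_simp at hxy
      exact hxy.symm
    have h := integral_image_eq_integral_abs_deriv_smul measurableSet_Ioi
      (f' := fun u => -(b / a / u ^ 2))
      (fun u hu => (((hasDerivAt_inv (ne_of_gt hu)).const_mul (b / a)).congr_deriv
        (by ring)).hasDerivWithinAt) hinj' fun u => g (a * u - b / u)
    simp only [← div_eq_mul_inv] at h
    rw [himage'] at h
    rw [h]
    refine setIntegral_congr_fun measurableSet_Ioi fun u hu => ?_
    have hu' : 0 < u := hu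
    have harg : a * (b / a / u) - b / (b / a / u) = -(a * u - b / u) := by
      field_simp
      ring
    simp only [harg, heven, smul_eq_mul, abs_neg]
    rw [abs_of_pos (by positivity)]
  have hinv' : ∫ u in Ioi (0 : ℝ), b / u ^ 2 * g (a * u - b / u)
      = a * ∫ u in Ioi (0 : ℝ), g (a * u - b / u) := by
    rw [hinv, ← integral_const_mul]
    refine integral_congr_ae (.of_forall fun u => ?_)
    simp only
    field_simp
  simp only [add_mul] at hsum
  rw [integral_add hint₁ hint₂, integral_const_mul, hinv'] at hsum
  rw [hsum]
  field_simp
  ring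

lemma integral_exp_neg_mul_sub_div_sq_Ioi {a b : ℝ} (ha : 0 < a) (hb : 0 ≤ b) :
    ∫ u in Ioi (0 : ℝ), Real.exp (-(a * u - b / u) ^ 2) = Real.sqrt Real.pi / (2 * a) := by
  rcases hb.eq_or_lt with rfl | hb
  · have h := integral_gaussian_Ioi (a ^ 2)
    rw [Real.sqrt_div Real.pi_pos.le, Real.sqrt_sq ha.le, div_div, mul_comm a] at h
    rw [← h]
    simp only [zero_div, sub_zero, mul_pow, neg_mul]
  · have hg : Integrable fun v : ℝ => Real.exp (-v ^ 2) := by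
      simpa using integrable_exp_neg_mul_sq one_pos
    have hval : ∫ v : ℝ, Real.exp (-v ^ 2) = Real.sqrt Real.pi := by
      simpa using integral_gaussian 1
    rw [← hval]
    exact integral_comp_mul_sub_div_Ioi hg (by fun_prop) (fun v => by simp) ha hb

/-- The Laplace transform of the Lévy distribution with scale parameter `λ > 0`:
`∫₀^∞ e^{-tx} f(x;λ) dx = e^{-√(2λt)}` for every `t ≥ 0`. -/
theorem levy_laplace_transform (l : ℝ) (hl : 0 < l) (t : ℝ) (ht : 0 ≤ t) :
    (∫ x in Set.Ioi (0:ℝ), Real.exp (-(t * x)) * levyPDFpos l x)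
      = Real.exp (-Real.sqrt (2 * l * t)) := by
  have ha : 0 < Real.sqrt (l / 2) := Real.sqrt_pos.mpr (by positivity)
  have ha2 : Real.sqrt (l / 2) ^ 2 = l / 2 := Real.sq_sqrt (by positivity)
  have hb2 : Real.sqrt t ^ 2 = t := Real.sq_sqrt ht
  have hab : Real.sqrt (2 * l * t) = 2 * Real.sqrt (l / 2) * Real.sqrt t := by
    rw [Real.sqrt_eq_iff_mul_self_eq (by positivity) (by positivity)]
    linear_combination -4 * Real.sqrt t ^ 2 * ha2 - 2 * l * hb2
  have hconst : Real.sqrt (l / (2 * Real.pi)) = Real.sqrt (l / 2) / Real.sqrt Real.pi := by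
    rw [← Real.sqrt_div (by positivity), div_div]
  rw [← integral_comp_rpow_Ioi _ (show (-2 : ℝ) ≠ 0 by norm_num)]
  have hcongr : ∀ u ∈ Ioi (0 : ℝ),
      (|(-2 : ℝ)| * u ^ ((-2 : ℝ) - 1)) •
        (Real.exp (-(t * u ^ (-2 : ℝ))) * levyPDFpos l (u ^ (-2 : ℝ)))
      = 2 * Real.sqrt (l / (2 * Real.pi)) * Real.exp (-Real.sqrt (2 * l * t)) *
        Real.exp (-(Real.sqrt (l / 2) * u - Real.sqrt t / u) ^ 2) := by
    intro u hu
    have hu' : 0 < u := hu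
    have hpow : u ^ ((-2 : ℝ) - 1) * (u ^ (-2 : ℝ)) ^ (-(3 : ℝ) / 2) = 1 := by
      rw [← Real.rpow_mul hu'.le, ← Real.rpow_add hu']
      norm_num
    have hsq : u ^ (-2 : ℝ) = (u ^ 2)⁻¹ := by
      rw [Real.rpow_neg hu'.le, Real.rpow_two]
    have hexp : Real.exp (-(t * u ^ (-2 : ℝ))) * Real.exp (-(l / (2 * u ^ (-2 : ℝ))))
        = Real.exp (-Real.sqrt (2 * l * t)) *
          Real.exp (-(Real.sqrt (l / 2) * u - Real.sqrt t / u) ^ 2) := by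
      rw [← Real.exp_add, ← Real.exp_add, hsq, hab]
      congr 1
      have hsplit : (Real.sqrt (l / 2) * u - Real.sqrt t / u) ^ 2
          = l / 2 * u ^ 2 - 2 * Real.sqrt (l / 2) * Real.sqrt t + t / u ^ 2 := by
        rw [sub_sq, mul_pow, div_pow, ha2, hb2]
        field_simp
      rw [hsplit]
      field_simp
      ring
    rw [levyPDFpos, smul_eq_mul, abs_neg, abs_two]
    linear_combination
      2 * Real.sqrt (l / (2 * Real.pi)) * Real.exp (-(t * u ^ (-2 : ℝ))) *
        Real.exp (-(l / (2 * u ^ (-2 : ℝ)))) * hpow + 2 * Real.sqrt (l / (2 * Real.pi)) * hexp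
  rw [setIntegral_congr_fun measurableSet_Ioi hcongr, integral_const_mul,
    integral_exp_neg_mul_sub_div_sq_Ioi ha (Real.sqrt_nonneg t), hconst]
  have hpi : 0 < Real.sqrt Real.pi := Real.sqrt_pos.mpr Real.pi_pos
  field_simp
end

section
/- Let X and Y be independent random variables, each having the Lévy distribution with scale parameter λ > 0, and let a, b ∈ (0,∞). Then the random variable (aX + bY)/(√a + √b)² also has the Lévy distribution with scale parameter λ; that is, the pushforward of the product measure under (x,y) ↦ (ax + by)/(√a + √b)² equals the Lévy distribution with scale parameter λ. -/
open MeasureTheory Set ProbabilityTheory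

/-- The density of the Lévy distribution with scale parameter `l`, extended by `0` off `(0,∞)`. -/
noncomputable def levyPDF (l x : ℝ) : ℝ :=
  if 0 < x then Real.sqrt (l / (2 * Real.pi)) * Real.exp (-(l / (2 * x))) * x ^ (-(3:ℝ)/2) else 0

/-- The Lévy distribution with scale parameter `l`, as a measure on `ℝ`. -/
noncomputable def levyMeasure (l : ℝ) : Measure ℝ :=
  volume.withDensity (fun x => ENNReal.ofReal (levyPDF l x))

open Filter Topology

/-- A form of the second fundamental theorem of calculus on an open interval, for a nonnegative
derivative and a primitive with finite limits at the endpoints. -/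
theorem lintegral_Ioo_of_hasDerivAt_of_tendsto {f f' : ℝ → ℝ} {a b fa fb : ℝ} (hab : a < b)
    (hderiv : ∀ x ∈ Ioo a b, HasDerivAt f (f' x) x) (hnonneg : ∀ x ∈ Ioo a b, 0 ≤ f' x)
    (ha : Tendsto f (𝓝[>] a) (𝓝 fa)) (hb : Tendsto f (𝓝[<] b) (𝓝 fb)) :
    ∫⁻ x in Ioo a b, ENNReal.ofReal (f' x) = ENNReal.ofReal (fb - fa) := by
  have hcont : ContinuousOn (extendFrom (Ioo a b) f) (Icc a b) :=
    continuousOn_Icc_extendFrom_Ioo (fun x hx => (hderiv x hx).continuousAt.continuousWithinAt)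
      ha hb
  have hext : ∀ x ∈ Ioo a b, HasDerivAt (extendFrom (Ioo a b) f) (f' x) x := by
    intro x hx
    refine (hderiv x hx).congr_of_eventuallyEq ?_
    filter_upwards [Ioo_mem_nhds hx.1 hx.2] with y hy
    exact extendFrom_eq (subset_closure hy)
      ((hderiv y hy).continuousAt.continuousWithinAt)
  have hint : IntegrableOn f' (Ioc a b) :=
    intervalIntegral.integrableOn_deriv_of_nonneg hcont hext hnonneg
  rw [← intervalIntegral.integral_eq_sub_of_hasDerivAt_of_tendsto hab hderiv
    ((intervalIntegrable_iff_integrableOn_Ioc_of_le hab.le).2 hint) ha hb,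
    intervalIntegral.integral_of_le hab.le, integral_Ioc_eq_integral_Ioo,
    ofReal_integral_eq_lintegral_ofReal (hint.mono_set Ioo_subset_Ioc_self)]
  exact (ae_restrict_iff' measurableSet_Ioo).2 (ae_of_all _ hnonneg)

/-- The primitive of `exp (-t² / 2)` vanishing at `0`. -/
noncomputable def gaussianPrimitive (u : ℝ) : ℝ :=
  ∫ t in (0 : ℝ)..u, Real.exp (-(1 / 2) * t ^ 2)

theorem hasDerivAt_gaussianPrimitive (u : ℝ) :
    HasDerivAt gaussianPrimitive (Real.exp (-(1 / 2) * u ^ 2)) u :=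
  intervalIntegral.integral_hasDerivAt_right
    (Continuous.intervalIntegrable (by fun_prop) _ _)
    (Continuous.stronglyMeasurableAtFilter (by fun_prop) _ _)
    (Continuous.continuousAt (by fun_prop))

theorem gaussianPrimitive_neg (u : ℝ) : gaussianPrimitive (-u) = -gaussianPrimitive u := by
  have h := intervalIntegral.integral_comp_neg (a := 0) (b := u)
    (fun t : ℝ => Real.exp (-(1 / 2) * t ^ 2))
  simp only [neg_sq, neg_zero] at h
  rw [gaussianPrimitive, gaussianPrimitive, h, intervalIntegral.integral_symm]

theorem tendsto_gaussianPrimitive_atTop :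
    Tendsto gaussianPrimitive atTop (𝓝 (√(2 * Real.pi) / 2)) := by
  have h := intervalIntegral_tendsto_integral_Ioi (0 : ℝ)
    (integrable_exp_neg_mul_sq (b := 1 / 2) (by norm_num)).integrableOn tendsto_id
  rw [integral_gaussian_Ioi] at h
  convert! h using 4
  ring

theorem tendsto_gaussianPrimitive_atBot :
    Tendsto gaussianPrimitive atBot (𝓝 (-(√(2 * Real.pi) / 2))) := by
  have h := (tendsto_gaussianPrimitive_atTop.comp tendsto_neg_atBot_atTop).neg
  refine h.congr fun u => ?_
  simp [gaussianPrimitive_neg]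

/-- A primitive of `r ↦ (2 / c) * (1 + 1 / r²) * exp (-((α r - β / r) / c)² / 2)` on `(0, ∞)`. -/
noncomputable def levyPrimitive (α β c r : ℝ) : ℝ :=
  (1 / α + 1 / β) * gaussianPrimitive ((α * r - β / r) / c) +
    (1 / α - 1 / β) * Real.exp (2 * α * β / c ^ 2) * gaussianPrimitive ((α * r + β / r) / c)

section levyPrimitive

variable {α β c : ℝ}

theorem hasDerivAt_levyPrimitive (hα : 0 < α) (hβ : 0 < β) (hc : 0 < c) {r : ℝ} (hr : 0 < r) :
    HasDerivAt (levyPrimitive α β c)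
      (2 / c * (1 + 1 / r ^ 2) * Real.exp (-(1 / 2) * ((α * r - β / r) / c) ^ 2)) r := by
  have hdiv : HasDerivAt (fun r : ℝ => β / r) (-β / r ^ 2) r := by
    simpa using (hasDerivAt_const r β).fun_div (hasDerivAt_id r) hr.ne'
  have hmul : HasDerivAt (fun r : ℝ => α * r) α r := by
    simpa using (hasDerivAt_id r).const_mul α
  have hu := (hasDerivAt_gaussianPrimitive _).comp r ((hmul.fun_sub hdiv).div_const c)
  have hv := (hasDerivAt_gaussianPrimitive _).comp r ((hmul.fun_add hdiv).div_const c)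
  have hexp : Real.exp (-(1 / 2) * ((α * r - β / r) / c) ^ 2) =
      Real.exp (2 * α * β / c ^ 2) * Real.exp (-(1 / 2) * ((α * r + β / r) / c) ^ 2) := by
    rw [← Real.exp_add]
    congr 1
    field_simp
    ring
  refine ((hu.const_mul (1 / α + 1 / β)).add
    (hv.const_mul ((1 / α - 1 / β) * Real.exp (2 * α * β / c ^ 2)))).congr_deriv ?_
  rw [hexp]
  field_simp
  ring

theorem tendsto_levyPrimitive_atTop (hα : 0 < α) (hc : 0 < c) :
    Tendsto (levyPrimitive α β c) atTop (𝓝 ((1 / α + 1 / β) * (√(2 * Real.pi) / 2) +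
      (1 / α - 1 / β) * Real.exp (2 * α * β / c ^ 2) * (√(2 * Real.pi) / 2))) := by
  have hdiv : Tendsto (fun r : ℝ => β / r) atTop (𝓝 0) := tendsto_const_nhds.div_atTop tendsto_id
  have hmul : Tendsto (fun r : ℝ => α * r) atTop atTop := tendsto_id.const_mul_atTop hα
  have hu := (hmul.atTop_add hdiv.neg).atTop_div_const hc
  have hv := (hmul.atTop_add hdiv).atTop_div_const hc
  exact ((tendsto_gaussianPrimitive_atTop.comp hu).const_mul _).add
    ((tendsto_gaussianPrimitive_atTop.comp hv).const_mul _)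

theorem tendsto_levyPrimitive_nhdsGT_zero (hβ : 0 < β) (hc : 0 < c) :
    Tendsto (levyPrimitive α β c) (𝓝[>] 0) (𝓝 ((1 / α + 1 / β) * -(√(2 * Real.pi) / 2) +
      (1 / α - 1 / β) * Real.exp (2 * α * β / c ^ 2) * (√(2 * Real.pi) / 2))) := by
  have hdiv : Tendsto (fun r : ℝ => β / r) (𝓝[>] 0) atTop :=
    tendsto_inv_nhdsGT_zero.const_mul_atTop hβ
  have hmul : Tendsto (fun r : ℝ => α * r) (𝓝[>] 0) (𝓝 0) := by
    have h : Tendsto (fun r : ℝ => α * r) (𝓝 0) (𝓝 (α * 0)) :=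
      Continuous.tendsto (by fun_prop) _
    rw [mul_zero] at h
    exact h.mono_left nhdsWithin_le_nhds
  have hu := (hmul.add_atBot (tendsto_neg_atTop_atBot.comp hdiv)).atBot_div_const hc
  have hv := (hmul.add_atTop hdiv).atTop_div_const hc
  exact ((tendsto_gaussianPrimitive_atBot.comp hu).const_mul _).add
    ((tendsto_gaussianPrimitive_atTop.comp hv).const_mul _)

end levyPrimitive

theorem levyPDF_of_nonpos (l : ℝ) {x : ℝ} (hx : x ≤ 0) : levyPDF l x = 0 :=
  if_neg hx.not_gt

theorem levyPDF_of_pos (l : ℝ) {x : ℝ} (hx : 0 < x) :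
    levyPDF l x = √l / √(2 * Real.pi) * Real.exp (-(l / (2 * x))) / √x ^ 3 := by
  have hpow : x ^ (-(3 : ℝ) / 2) = (√x ^ 3)⁻¹ := by
    rw [Real.sqrt_eq_rpow, ← Real.rpow_natCast, ← Real.rpow_mul hx.le, ← Real.rpow_neg hx.le]
    norm_num
  rw [levyPDF, if_pos hx, hpow, Real.sqrt_div' _ (by positivity), div_eq_mul_inv _ (√x ^ 3)]

theorem levyPDF_nonneg (l x : ℝ) : 0 ≤ levyPDF l x := by
  unfold levyPDF
  split_ifs <;> positivity

@[fun_prop]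
theorem measurable_levyPDF (l : ℝ) : Measurable (levyPDF l) :=
  Measurable.ite measurableSet_Ioi (by fun_prop) measurable_const

instance (l : ℝ) : SFinite (levyMeasure l) := by
  unfold levyMeasure
  infer_instance

theorem levyMeasure_ne_zero {l : ℝ} (hl : 0 < l) : levyMeasure l ≠ 0 := by
  intro h
  rw [levyMeasure, withDensity_eq_zero_iff (by fun_prop)] at h
  have hpos : ∀ x ∈ Ioi (0 : ℝ), ENNReal.ofReal (levyPDF l x) ≠ 0 := by
    intro x hx
    have : 0 < x := hx
    rw [levyPDF_of_pos l hx, ne_eq, ENNReal.ofReal_eq_zero, not_le]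
    positivity
  have h0 : volume (Ioi (0 : ℝ)) = 0 := measure_mono_null hpos (ae_iff.1 h)
  simp at h0

theorem mul_levyPDF_mul (l x : ℝ) {c : ℝ} (hc : 0 < c) :
    c * levyPDF (c * l) (c * x) = levyPDF l x := by
  rcases le_or_gt x 0 with hx | hx
  · rw [levyPDF_of_nonpos _ hx, levyPDF_of_nonpos _ (by nlinarith), mul_zero]
  · rw [levyPDF_of_pos _ hx, levyPDF_of_pos _ (by positivity), Real.sqrt_mul hc.le,
      Real.sqrt_mul hc.le, mul_left_comm 2 c x, mul_div_mul_left _ _ hc.ne']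
    have hs : √c ^ 2 = c := Real.sq_sqrt hc.le
    have : 0 < √c := by positivity
    nth_rewrite 1 [← hs]
    field_simp

/-- Scaling a Lévy variable by `c > 0` scales its parameter by `c`. -/
theorem map_mul_levyMeasure (l : ℝ) {c : ℝ} (hc : 0 < c) :
    (levyMeasure l).map (c * ·) = levyMeasure (c * l) := by
  ext s hs
  have hscale : ∫⁻ x in s, ENNReal.ofReal (levyPDF (c * l) x) =
      ENNReal.ofReal |c| * ∫⁻ x in (c * ·) ⁻¹' s, ENNReal.ofReal (levyPDF (c * l) (c * x)) := by
    conv_lhs => rw [← Real.smul_map_volume_mul_left hc.ne']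
    rw [Measure.restrict_smul, lintegral_smul_measure,
      setLIntegral_map hs (by fun_prop) (by fun_prop), smul_eq_mul]
  rw [Measure.map_apply (by fun_prop) hs, levyMeasure, levyMeasure, withDensity_apply _ hs,
    withDensity_apply _ (hs.preimage (by fun_prop)), hscale,
    ← lintegral_const_mul _ (by fun_prop)]
  simp only [abs_of_pos hc, ← ENNReal.ofReal_mul hc.le, mul_levyPDF_mul l _ hc]

section Convolution

variable {α β s : ℝ}

theorem hasDerivAt_sqrt_sub_div_sqrt {x : ℝ} (hx : x ∈ Ioo 0 s) :
    HasDerivAt (fun x => √(s - x) / √x) (-(s / (2 * √(s - x) * √x ^ 3))) x := by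
  have hx0 : 0 < x := hx.1
  have hxs : 0 < s - x := sub_pos.2 hx.2
  have hp : 0 < √x := Real.sqrt_pos.2 hx0
  have hq : 0 < √(s - x) := Real.sqrt_pos.2 hxs
  have hsum : s = √x ^ 2 + √(s - x) ^ 2 := by
    rw [Real.sq_sqrt hx0.le, Real.sq_sqrt hxs.le]
    ring
  refine ((((hasDerivAt_id x).const_sub s).sqrt hxs.ne').fun_div
    ((hasDerivAt_id x).sqrt hx0.ne') hp.ne').congr_deriv ?_
  simp only [id]
  generalize √x = p at *
  generalize √(s - x) = q at *
  subst hsum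
  field_simp
  ring

theorem levyPDF_mul_levyPDF_sub (hα : 0 < α) (hβ : 0 < β) {x : ℝ} (hx : x ∈ Ioo 0 s) :
    levyPDF (α ^ 2) x * levyPDF (β ^ 2) (s - x) =
      -(α * β / (2 * Real.pi) * Real.exp (-((α + β) ^ 2 / (2 * s))) / √s ^ 3) *
        (2 / √s * (1 + 1 / (√(s - x) / √x) ^ 2) *
          Real.exp (-(1 / 2) *
            ((α * (√(s - x) / √x) - β / (√(s - x) / √x)) / √s) ^ 2) *
          -(s / (2 * √(s - x) * √x ^ 3))) := by
  have hx0 : 0 < x := hx.1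
  have hxs : 0 < s - x := sub_pos.2 hx.2
  have hs : 0 < s := hx0.trans hx.2
  have hp : 0 < √x := Real.sqrt_pos.2 hx0
  have hq : 0 < √(s - x) := Real.sqrt_pos.2 hxs
  have hc : 0 < √s := Real.sqrt_pos.2 hs
  have hpi : √(2 * Real.pi) ^ 2 = 2 * Real.pi := Real.sq_sqrt (by positivity)
  have hpi0 : 0 < √(2 * Real.pi) := by positivity
  have hxp : x = √x ^ 2 := (Real.sq_sqrt hx0.le).symm
  have hxq : s - x = √(s - x) ^ 2 := (Real.sq_sqrt hxs.le).symm
  have hsc : s = √s ^ 2 := (Real.sq_sqrt hs.le).symm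
  have hsum : √s ^ 2 = √x ^ 2 + √(s - x) ^ 2 := by
    rw [← hxp, ← hxq, ← hsc]
    ring
  have hexp : Real.exp (-(α ^ 2 / (2 * x))) * Real.exp (-(β ^ 2 / (2 * (s - x)))) =
      Real.exp (-((α + β) ^ 2 / (2 * s))) * Real.exp (-(1 / 2) *
        ((α * (√(s - x) / √x) - β / (√(s - x) / √x)) / √s) ^ 2) := by
    rw [← Real.exp_add, ← Real.exp_add, div_pow _ (√s), ← hsc]
    congr 1
    generalize √x = p at *
    generalize √(s - x) = q at *
    rw [hxq, show s = p ^ 2 + q ^ 2 by linarith, hxp]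
    field_simp
    ring
  have hcoef : α * β / √(2 * Real.pi) ^ 2 / (√x ^ 3 * √(s - x) ^ 3) =
      α * β / (2 * Real.pi) / √s ^ 3 * (2 / √s * (1 + 1 / (√(s - x) / √x) ^ 2) *
        (s / (2 * √(s - x) * √x ^ 3))) := by
    rw [hpi]
    generalize √x = p at *
    generalize √(s - x) = q at *
    generalize √s = c at *
    rw [hsc]
    field_simp
    linarith
  rw [levyPDF_of_pos _ hx0, levyPDF_of_pos _ hxs, Real.sqrt_sq hα.le, Real.sqrt_sq hβ.le]
  linear_combination
    (Real.exp (-(α ^ 2 / (2 * x))) * Real.exp (-(β ^ 2 / (2 * (s - x))))) * hcoef +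
      α * β / (2 * Real.pi) / √s ^ 3 * (2 / √s * (1 + 1 / (√(s - x) / √x) ^ 2) *
        (s / (2 * √(s - x) * √x ^ 3))) * hexp

/-- The densities of the Lévy distributions with parameters `α²` and `β²` convolve to the density
of the Lévy distribution with parameter `(α + β)²`. -/
theorem lintegral_levyPDF_mul_levyPDF_sub (hα : 0 < α) (hβ : 0 < β) (s : ℝ) :
    ∫⁻ x, ENNReal.ofReal (levyPDF (α ^ 2) x) * ENNReal.ofReal (levyPDF (β ^ 2) (s - x)) =
      ENNReal.ofReal (levyPDF ((α + β) ^ 2) s) := by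
  simp only [← ENNReal.ofReal_mul (levyPDF_nonneg _ _)]
  have hsupp : ∀ x ∉ Ioo 0 s, levyPDF (α ^ 2) x * levyPDF (β ^ 2) (s - x) = 0 := by
    intro x hx
    rcases le_or_gt x 0 with h | h
    · rw [levyPDF_of_nonpos _ h, zero_mul]
    · rw [levyPDF_of_nonpos _ (sub_nonpos.2 (not_lt.1 fun h' => hx ⟨h, h'⟩)), mul_zero]
  rw [← setLIntegral_eq_of_support_subset (s := Ioo 0 s) ?_]
  swap
  · intro x hx
    by_contra h
    simp [hsupp x h] at hx
  rcases le_or_gt s 0 with hs | hs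
  · simp [Ioo_eq_empty hs.not_gt, levyPDF_of_nonpos _ hs]
  have hc : 0 < √s := Real.sqrt_pos.2 hs
  have hratio : ∀ x ∈ Ioo 0 s, 0 < √(s - x) / √x := fun x hx =>
    div_pos (Real.sqrt_pos.2 (sub_pos.2 hx.2)) (Real.sqrt_pos.2 hx.1)
  have hzero : Tendsto (fun x => √(s - x) / √x) (𝓝[>] 0) atTop := by
    have hnum : Tendsto (fun x => √(s - x)) (𝓝[>] 0) (𝓝 √s) := by
      have h : Tendsto (fun x => √(s - x)) (𝓝 0) (𝓝 √(s - 0)) :=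
        Continuous.tendsto (by fun_prop) _
      rw [sub_zero] at h
      exact h.mono_left nhdsWithin_le_nhds
    have hden : Tendsto (fun x => √x) (𝓝[>] 0) (𝓝[>] 0) := by
      refine tendsto_nhdsWithin_iff.2 ⟨?_, ?_⟩
      · have h := Real.continuous_sqrt.tendsto 0
        rw [Real.sqrt_zero] at h
        exact h.mono_left nhdsWithin_le_nhds
      · filter_upwards [self_mem_nhdsWithin] with x hx using Real.sqrt_pos.2 hx
    exact hnum.pos_mul_atTop hc (tendsto_inv_nhdsGT_zero.comp hden)
  have hend : Tendsto (fun x => √(s - x) / √x) (𝓝[<] s) (𝓝[>] 0) := by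
    refine tendsto_nhdsWithin_iff.2 ⟨?_, ?_⟩
    · have h : ContinuousAt (fun x => √(s - x) / √x) s :=
        ContinuousAt.div (by fun_prop) (by fun_prop) hc.ne'
      have h' := h.tendsto
      simp only [sub_self, Real.sqrt_zero, zero_div] at h'
      exact h'.mono_left nhdsWithin_le_nhds
    · filter_upwards [Ioo_mem_nhdsLT hs] with x hx using hratio x hx
  rw [lintegral_Ioo_of_hasDerivAt_of_tendsto hs
    (fun x hx => (((hasDerivAt_levyPrimitive hα hβ hc (hratio x hx)).comp x
      (hasDerivAt_sqrt_sub_div_sqrt hx)).const_mul _).congr_deriv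
        (levyPDF_mul_levyPDF_sub hα hβ hx).symm)
    (fun x _ => mul_nonneg (levyPDF_nonneg _ _) (levyPDF_nonneg _ _))
    (((tendsto_levyPrimitive_atTop hα hc).comp hzero).const_mul _)
    (((tendsto_levyPrimitive_nhdsGT_zero hβ hc).comp hend).const_mul _),
    levyPDF_of_pos _ hs, Real.sqrt_sq (by positivity)]
  congr 1
  have hpi : √(2 * Real.pi) ^ 2 = 2 * Real.pi := Real.sq_sqrt (by positivity)
  have hpi0 : 0 < √(2 * Real.pi) := by positivity
  generalize √(2 * Real.pi) = w at *
  rw [← hpi]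
  field_simp
  ring

theorem levyMeasure_conv_levyMeasure (hα : 0 < α) (hβ : 0 < β) :
    (levyMeasure (α ^ 2)).conv (levyMeasure (β ^ 2)) = levyMeasure ((α + β) ^ 2) := by
  rw [levyMeasure, levyMeasure, conv_withDensity_eq_lconvolution (by fun_prop) (by fun_prop),
    levyMeasure]
  congr 1
  ext s
  simp only [lconvolution_def, neg_add_eq_sub, lintegral_levyPDF_mul_levyPDF_sub hα hβ]

end Convolution

theorem map_levyMeasure_prod_levyMeasure {l a b : ℝ} (hl : 0 < l) (ha : 0 < a) (hb : 0 < b) :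
    Measure.map (fun p : ℝ × ℝ => (a * p.1 + b * p.2) / (√a + √b) ^ 2)
      ((levyMeasure l).prod (levyMeasure l)) = levyMeasure l := by
  have hc : 0 < ((√a + √b) ^ 2)⁻¹ := by positivity
  have hcomp : (fun p : ℝ × ℝ => (a * p.1 + b * p.2) / (√a + √b) ^ 2) =
      (((√a + √b) ^ 2)⁻¹ * ·) ∘ (fun p : ℝ × ℝ => p.1 + p.2) ∘ Prod.map (a * ·) (b * ·) := by
    ext p
    simp only [Function.comp_apply, Prod.map_fst, Prod.map_snd]
    ring
  have hsq : ∀ {t : ℝ}, 0 < t → t * l = (√t * √l) ^ 2 := fun ht => by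
    rw [mul_pow, Real.sq_sqrt ht.le, Real.sq_sqrt hl.le]
  have hscale : ((√a + √b) ^ 2)⁻¹ * (√a * √l + √b * √l) ^ 2 = l := by
    rw [← add_mul, mul_pow, Real.sq_sqrt hl.le]
    field_simp
  rw [hcomp, ← Measure.map_map (by fun_prop) (by fun_prop),
    ← Measure.map_map (by fun_prop) (by fun_prop),
    ← Measure.map_prod_map _ _ (by fun_prop) (by fun_prop), map_mul_levyMeasure l ha,
    map_mul_levyMeasure l hb, hsq ha, hsq hb, ← Measure.conv,
    levyMeasure_conv_levyMeasure (by positivity) (by positivity), map_mul_levyMeasure _ hc, hscale]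

/-- Stability of the Lévy distribution: if `X, Y` are independent Lévy(λ) random variables and
`a, b > 0`, then `(aX + bY)/(√a + √b)²` is again Lévy(λ); that is, the pushforward of the
product measure under `(x,y) ↦ (ax + by)/(√a + √b)²` equals the Lévy distribution with scale
parameter `λ`. -/
theorem levy_stability {Ω : Type*} [MeasurableSpace Ω] (μ : Measure Ω) [IsProbabilityMeasure μ]
    (X Y : Ω → ℝ) (l a b : ℝ) (hl : 0 < l) (ha : 0 < a) (hb : 0 < b)
    (hindep : IndepFun X Y μ)
    (hX : Measure.map X μ = levyMeasure l) (hY : Measure.map Y μ = levyMeasure l) :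
    Measure.map (fun ω => (a * X ω + b * Y ω) / (Real.sqrt a + Real.sqrt b)^2) μ
      = levyMeasure l ∧
    Measure.map (fun p : ℝ × ℝ => (a * p.1 + b * p.2) / (Real.sqrt a + Real.sqrt b)^2)
      ((levyMeasure l).prod (levyMeasure l)) = levyMeasure l := by
  have hprod := map_levyMeasure_prod_levyMeasure hl ha hb
  refine ⟨?_, hprod⟩
  have hXm : AEMeasurable X μ := aemeasurable_of_map_neZero ⟨hX ▸ levyMeasure_ne_zero hl⟩
  have hYm : AEMeasurable Y μ := aemeasurable_of_map_neZero ⟨hY ▸ levyMeasure_ne_zero hl⟩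
  have hXY := hindep.map_prod_eq_prod_map_map hXm hYm
  rw [hX, hY] at hXY
  rw [← hXY, AEMeasurable.map_map_of_aemeasurable (by fun_prop) (hXm.prodMk hYm)] at hprod
  exact hprod
end

section
/- Fix a > 0 and t ∈ (0,1), and write L = −log t. If X has the standard Lévy distribution, then the variance function of the limiting Gaussian process in Theorem 1 satisfies σ²(t) = 4·∫₀^∞ ψ(x;t,a)² f₀(x) dx = t^{2a} · L³ · (4 e^{−√(2L) − √L} − 4 e^{−√(5L/2) − √(L/2)} + e^{−2√L} − e^{−2√(2L)}). -/
open MeasureTheory Set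

/-- The density of the standard Lévy distribution, for `x > 0`. -/
noncomputable def stdLevyPDF (x : ℝ) : ℝ :=
  (1 / Real.sqrt (2 * Real.pi)) * Real.exp (-(1 / (2 * x))) * x ^ (-(3:ℝ)/2)

/-- The first projection `ψ(x;t,a)` of the kernel
`Ψ(x,y;t,a) = t^a (-log t)^{3/2} ((t^x + t^y)/2 - t^{(x+y)/4})`. -/
noncomputable def levyProjPsi (t a x : ℝ) : ℝ :=
  (1/2) * t ^ a * (-Real.log t) ^ ((3:ℝ)/2) *
    (-2 * t ^ (x/4) * Real.exp (-(Real.sqrt (-Real.log t) / Real.sqrt 2)) + t ^ x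
      + Real.exp (-(Real.sqrt 2 * Real.sqrt (-Real.log t))))

open Filter Topology

/-- The unnormalised Gaussian primitive `z ↦ ∫₀ᶻ e^{-u²/2} du`. -/
noncomputable def gaussPrimitive (z : ℝ) : ℝ :=
  ∫ u in (0:ℝ)..z, Real.exp (-(1/2) * u ^ 2)

lemma hasDerivAt_gaussPrimitive (z : ℝ) :
    HasDerivAt gaussPrimitive (Real.exp (-(1/2) * z ^ 2)) z := by
  have hc : Continuous fun u : ℝ => Real.exp (-(1/2) * u ^ 2) := by fun_prop
  exact intervalIntegral.integral_hasDerivAt_right (hc.intervalIntegrable _ _)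
    (hc.stronglyMeasurableAtFilter _ _) hc.continuousAt

lemma gaussPrimitive_zero : gaussPrimitive 0 = 0 := by
  simp [gaussPrimitive]

lemma gaussPrimitive_neg (z : ℝ) : gaussPrimitive (-z) = -gaussPrimitive z := by
  have h := intervalIntegral.integral_comp_neg (a := 0) (b := z)
    (fun u : ℝ => Real.exp (-(1/2) * u ^ 2))
  simp only [neg_sq, neg_zero] at h
  rw [gaussPrimitive, gaussPrimitive, h, intervalIntegral.integral_symm]

lemma tendsto_gaussPrimitive_atTop :
    Tendsto gaussPrimitive atTop (𝓝 (√(2 * Real.pi) / 2)) := by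
  have h := intervalIntegral_tendsto_integral_Ioi (0:ℝ)
    (integrable_exp_neg_mul_sq (by norm_num : (0:ℝ) < 1/2)).integrableOn tendsto_id
  rw [integral_gaussian_Ioi] at h
  rwa [div_div_eq_mul_div, div_one, mul_comm Real.pi] at h

lemma tendsto_gaussPrimitive_atBot :
    Tendsto gaussPrimitive atBot (𝓝 (-(√(2 * Real.pi) / 2))) := by
  have h := (tendsto_gaussPrimitive_atTop.comp tendsto_neg_atBot_atTop).neg
  refine h.congr fun z => ?_
  simp [gaussPrimitive_neg]

/-- Up to normalisation, the distribution function of the first passage time to level `1` of a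
Brownian motion with drift `b`. -/
noncomputable def passagePrimitive (b x : ℝ) : ℝ :=
  gaussPrimitive (b * √x - (√x)⁻¹) + Real.exp (2 * b) * gaussPrimitive (-(b * √x) - (√x)⁻¹)

lemma stdLevyPDF_eq {x : ℝ} (hx : 0 < x) :
    stdLevyPDF x = (√(2 * Real.pi))⁻¹ * Real.exp (-(1 / (2 * x))) * ((√x) ^ 3)⁻¹ := by
  have h : x ^ (-(3:ℝ)/2) = ((√x) ^ 3)⁻¹ := by
    rw [Real.sqrt_eq_rpow, ← Real.rpow_natCast, ← Real.rpow_mul hx.le, ← Real.rpow_neg hx.le]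
    norm_num
  rw [stdLevyPDF, h, one_div]

lemma stdLevyPDF_nonneg {x : ℝ} (hx : 0 < x) : 0 ≤ stdLevyPDF x := by
  rw [stdLevyPDF_eq hx]
  positivity

lemma hasDerivAt_passagePrimitive (b : ℝ) {x : ℝ} (hx : 0 < x) :
    HasDerivAt (passagePrimitive b)
      (√(2 * Real.pi) * Real.exp b * (Real.exp (-(b ^ 2 / 2 * x)) * stdLevyPDF x)) x := by
  have hr : 0 < √x := Real.sqrt_pos.2 hx
  have hs : HasDerivAt (fun y : ℝ => √y) (1 / (2 * √x)) x := Real.hasDerivAt_sqrt hx.ne'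
  have hi : HasDerivAt (fun y : ℝ => (√y)⁻¹) (-(1 / (2 * √x)) / √x ^ 2) x := hs.fun_inv hr.ne'
  have hu := (hasDerivAt_gaussPrimitive (b * √x - (√x)⁻¹)).comp x ((hs.const_mul b).sub hi)
  have hv := (hasDerivAt_gaussPrimitive (-(b * √x) - (√x)⁻¹)).comp x
    ((hs.const_mul b).neg.sub hi)
  have hH := hu.add (hv.const_mul (Real.exp (2 * b)))
  refine HasDerivAt.congr_deriv hH ?_
  have hsq : √x ^ 2 = x := Real.sq_sqrt hx.le
  have hπ : √(2 * Real.pi) ≠ 0 := by positivity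
  have e1 : Real.exp (-(1/2) * (b * √x - (√x)⁻¹) ^ 2) =
      Real.exp b * Real.exp (-(b ^ 2 / 2 * x)) * Real.exp (-(1 / (2 * x))) := by
    rw [← Real.exp_add, ← Real.exp_add]
    congr 1
    rw [← hsq, Real.sqrt_sq hr.le]
    field_simp
    ring
  have e2 : Real.exp (-(1/2) * (-(b * √x) - (√x)⁻¹) ^ 2) =
      Real.exp (-b) * Real.exp (-(b ^ 2 / 2 * x)) * Real.exp (-(1 / (2 * x))) := by
    rw [← Real.exp_add, ← Real.exp_add]
    congr 1
    rw [← hsq, Real.sqrt_sq hr.le]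
    field_simp
    ring
  have e3 : Real.exp (2 * b) * Real.exp (-b) = Real.exp b := by
    rw [← Real.exp_add]
    congr 1
    ring
  rw [e1, e2, stdLevyPDF_eq hx, ← mul_assoc (Real.exp (2 * b)), ← mul_assoc (Real.exp (2 * b)),
    ← mul_assoc (Real.exp (2 * b)), e3]
  field_simp
  ring

lemma tendsto_passagePrimitive_zero {b : ℝ} :
    Tendsto (passagePrimitive b) (𝓝[>] 0)
      (𝓝 (-(√(2 * Real.pi) / 2) + Real.exp (2 * b) * -(√(2 * Real.pi) / 2))) := by
  have hs : Tendsto (fun x : ℝ => √x) (𝓝[>] 0) (𝓝 0) := by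
    simpa using (Real.continuous_sqrt.tendsto 0).mono_left nhdsWithin_le_nhds
  have hs' : Tendsto (fun x : ℝ => √x) (𝓝[>] 0) (𝓝[>] 0) :=
    tendsto_nhdsWithin_iff.2 ⟨hs, by
      filter_upwards [self_mem_nhdsWithin] with x hx using Real.sqrt_pos.2 hx⟩
  have hi : Tendsto (fun x : ℝ => -(√x)⁻¹) (𝓝[>] 0) atBot :=
    tendsto_neg_atTop_atBot.comp (tendsto_inv_nhdsGT_zero.comp hs')
  have hb : Tendsto (fun x : ℝ => b * √x) (𝓝[>] 0) (𝓝 (b * 0)) := hs.const_mul b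
  exact (tendsto_gaussPrimitive_atBot.comp (hb.add_atBot hi)).add
    ((tendsto_gaussPrimitive_atBot.comp (hb.neg.add_atBot hi)).const_mul _)

lemma tendsto_passagePrimitive_atTop {b : ℝ} (hb : 0 ≤ b) :
    Tendsto (passagePrimitive b) atTop
      (𝓝 (√(2 * Real.pi) / 2 + Real.exp (2 * b) * -(√(2 * Real.pi) / 2))) := by
  have hi : Tendsto (fun x : ℝ => -(√x)⁻¹) atTop (𝓝 (-0)) :=
    (tendsto_inv_atTop_zero.comp Real.tendsto_sqrt_atTop).neg
  rcases hb.eq_or_lt with rfl | hb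
  · have hG : Tendsto gaussPrimitive (𝓝 (-0)) (𝓝 0) := by
      simpa [gaussPrimitive_zero] using (hasDerivAt_gaussPrimitive 0).continuousAt.tendsto
    have h := (hG.comp hi).add ((hG.comp hi).const_mul (Real.exp (2 * 0)))
    have he : passagePrimitive 0 = fun x => gaussPrimitive (-(√x)⁻¹) + gaussPrimitive (-(√x)⁻¹) := by
      ext x
      simp [passagePrimitive]
    simpa [he, Function.comp_def] using h
  · have hm : Tendsto (fun x : ℝ => b * √x) atTop atTop :=
      Real.tendsto_sqrt_atTop.const_mul_atTop hb
    exact (tendsto_gaussPrimitive_atTop.comp (hm.atTop_add hi)).add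
      ((tendsto_gaussPrimitive_atBot.comp
        ((tendsto_neg_atTop_atBot.comp hm).atBot_add hi)).const_mul _)

lemma integrableOn_and_integral_exp_mul_stdLevyPDF {b : ℝ} (hb : 0 ≤ b) :
    IntegrableOn (fun x => Real.exp (-(b ^ 2 / 2 * x)) * stdLevyPDF x) (Ioi 0) ∧
      ∫ x in Ioi (0:ℝ), Real.exp (-(b ^ 2 / 2 * x)) * stdLevyPDF x = Real.exp (-b) := by
  set c := √(2 * Real.pi) * Real.exp b with hc
  have hc0 : 0 < c := by positivity
  set F := Function.update (passagePrimitive b) 0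
    (-(√(2 * Real.pi) / 2) + Real.exp (2 * b) * -(√(2 * Real.pi) / 2)) with hF
  have hcont : ContinuousWithinAt F (Ici 0) 0 := by
    rw [hF, continuousWithinAt_update_same, Ici_sdiff_left]
    exact tendsto_passagePrimitive_zero
  have hderiv : ∀ x ∈ Ioi (0:ℝ),
      HasDerivAt F (c * (Real.exp (-(b ^ 2 / 2 * x)) * stdLevyPDF x)) x := fun x hx => by
    refine (hasDerivAt_passagePrimitive b hx).congr_of_eventuallyEq ?_
    filter_upwards [lt_mem_nhds hx] with y hy using Function.update_of_ne hy.ne' _ _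
  have hpos : ∀ x ∈ Ioi (0:ℝ), 0 ≤ c * (Real.exp (-(b ^ 2 / 2 * x)) * stdLevyPDF x) :=
    fun x hx => mul_nonneg hc0.le (mul_nonneg (Real.exp_pos _).le (stdLevyPDF_nonneg hx))
  have hlim : Tendsto F atTop
      (𝓝 (√(2 * Real.pi) / 2 + Real.exp (2 * b) * -(√(2 * Real.pi) / 2))) := by
    refine (tendsto_passagePrimitive_atTop hb).congr' ?_
    filter_upwards [eventually_gt_atTop 0] with y hy using (Function.update_of_ne hy.ne' _ _).symm
  have hint := integrableOn_Ioi_deriv_of_nonneg hcont hderiv hpos hlim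
  have heq := integral_Ioi_of_hasDerivAt_of_nonneg hcont hderiv hpos hlim
  refine ⟨(integrable_const_mul_iff hc0.ne'.isUnit _).1 hint, ?_⟩
  rw [integral_const_mul, hF, Function.update_self] at heq
  refine mul_left_cancel₀ hc0.ne' (heq.trans ?_)
  rw [hc, mul_assoc, ← Real.exp_add]
  simp

lemma integrableOn_exp_mul_stdLevyPDF {s : ℝ} (hs : 0 ≤ s) :
    IntegrableOn (fun x => Real.exp (-(s * x)) * stdLevyPDF x) (Ioi 0) := by
  have h := (integrableOn_and_integral_exp_mul_stdLevyPDF (Real.sqrt_nonneg (2 * s))).1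
  rwa [Real.sq_sqrt (by positivity), mul_div_cancel_left₀ s two_ne_zero] at h

/-- The Laplace transform of the standard Lévy distribution. -/
lemma integral_exp_mul_stdLevyPDF {s : ℝ} (hs : 0 ≤ s) :
    ∫ x in Ioi (0:ℝ), Real.exp (-(s * x)) * stdLevyPDF x = Real.exp (-√(2 * s)) := by
  have h := (integrableOn_and_integral_exp_mul_stdLevyPDF (Real.sqrt_nonneg (2 * s))).2
  rwa [Real.sq_sqrt (by positivity), mul_div_cancel_left₀ s two_ne_zero] at h

/-- Expansion of the squared projection as a combination of exponentials of `x`. -/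
lemma levyProjPsi_sq {t a L : ℝ} (ht : t ∈ Ioo (0:ℝ) 1) (hL : L = -Real.log t) (x : ℝ) :
    4 * levyProjPsi t a x ^ 2 = t ^ (2 * a) * L ^ 3 *
      (4 * Real.exp (-√(L / 2)) ^ 2 * Real.exp (-(L / 2 * x)) + Real.exp (-(2 * L * x))
        + Real.exp (-√(L / 2)) ^ 4 * Real.exp (-(0 * x))
        - 4 * Real.exp (-√(L / 2)) * Real.exp (-(5 * L / 4 * x))
        - 4 * Real.exp (-√(L / 2)) ^ 3 * Real.exp (-(L / 4 * x))
        + 2 * Real.exp (-√(L / 2)) ^ 2 * Real.exp (-(L * x))) := by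
  have hL0 : 0 < L := by rw [hL]; linarith [Real.log_neg ht.1 ht.2]
  have hpow (y : ℝ) : t ^ y = Real.exp (-(L * y)) := by
    rw [Real.rpow_def_of_pos ht.1, hL, neg_mul, neg_neg]
  have hta : t ^ (2 * a) = (t ^ a) ^ 2 := by
    rw [mul_comm, Real.rpow_mul ht.1.le, Real.rpow_two]
  have hL3 : L ^ 3 = (L ^ ((3:ℝ)/2)) ^ 2 := by
    rw [← Real.rpow_natCast (L ^ ((3:ℝ)/2)), ← Real.rpow_mul hL0.le, ← Real.rpow_natCast]
    norm_num
  have hc : √L / √2 = √(L / 2) := (Real.sqrt_div hL0.le 2).symm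
  have hd : Real.exp (-(√2 * √L)) = Real.exp (-√(L / 2)) ^ 2 := by
    rw [← Real.exp_nat_mul, ← hc]
    congr 1
    have h2 : √2 * √2 = 2 := Real.mul_self_sqrt (by norm_num)
    field_simp
    push_cast
    linear_combination -h2
  have hA (n : ℕ) (s : ℝ) (h : s = n * (L / 4)) :
      Real.exp (-(s * x)) = Real.exp (-(L / 4 * x)) ^ n := by
    rw [← Real.exp_nat_mul, h]
    congr 1
    ring
  rw [levyProjPsi, ← hL, hta, hL3, hc, hd, hpow (x / 4), hpow x,
    show L * (x / 4) = L / 4 * x by ring, hA 4 L (by push_cast; ring),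
    hA 2 (L / 2) (by push_cast; ring), hA 8 (2 * L) (by push_cast; ring),
    hA 5 (5 * L / 4) (by push_cast; ring), hA 0 0 (by simp)]
  ring

/-- The variance function of the limiting Gaussian process: with `L = -log t`,
`σ²(t) = 4 E[ψ(X;t,a)²]
  = t^{2a} L³ (4 e^{-√(2L)-√L} - 4 e^{-√(5L/2)-√(L/2)} + e^{-2√L} - e^{-2√(2L)})`. -/
theorem variance_of_limit_process (a t : ℝ) (ha : 0 < a) (ht : t ∈ Set.Ioo (0:ℝ) 1)
    (L : ℝ) (hL : L = -Real.log t) :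
    4 * (∫ x in Set.Ioi (0:ℝ), (levyProjPsi t a x)^2 * stdLevyPDF x)
      = t ^ (2*a) * L^3 *
          (4 * Real.exp (-Real.sqrt (2*L) - Real.sqrt L)
            - 4 * Real.exp (-Real.sqrt (5*L/2) - Real.sqrt (L/2))
            + Real.exp (-(2 * Real.sqrt L))
            - Real.exp (-(2 * Real.sqrt (2*L)))) := by
  have hL0 : 0 < L := by rw [hL]; linarith [Real.log_neg ht.1 ht.2]
  have hI (k s : ℝ) (hs : 0 ≤ s) : IntegrableOn
      (fun x => k * (Real.exp (-(s * x)) * stdLevyPDF x)) (Ioi 0) :=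
    (integrableOn_exp_mul_stdLevyPDF hs).const_mul k
  set c := Real.exp (-√(L / 2)) with hc
  have h1 := hI (4 * c ^ 2) (L / 2) (by positivity)
  have h2 := hI 1 (2 * L) (by positivity)
  have h3 := hI (c ^ 4) 0 le_rfl
  have h4 := hI (4 * c) (5 * L / 4) (by positivity)
  have h5 := hI (4 * c ^ 3) (L / 4) (by positivity)
  have h6 := hI (2 * c ^ 2) L hL0.le
  have h12 := h1.fun_add h2
  have h123 := h12.fun_add h3
  have h1234 := h123.fun_sub h4
  have h12345 := h1234.fun_sub h5
  have hsum : ∀ x, 4 * (levyProjPsi t a x ^ 2 * stdLevyPDF x) = t ^ (2 * a) * L ^ 3 *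
      (4 * c ^ 2 * (Real.exp (-(L / 2 * x)) * stdLevyPDF x)
        + 1 * (Real.exp (-(2 * L * x)) * stdLevyPDF x)
        + c ^ 4 * (Real.exp (-(0 * x)) * stdLevyPDF x)
        - 4 * c * (Real.exp (-(5 * L / 4 * x)) * stdLevyPDF x)
        - 4 * c ^ 3 * (Real.exp (-(L / 4 * x)) * stdLevyPDF x)
        + 2 * c ^ 2 * (Real.exp (-(L * x)) * stdLevyPDF x)) := fun x => by
    rw [← mul_assoc, levyProjPsi_sq ht hL]
    ring
  rw [← integral_const_mul]
  simp only [hsum]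
  rw [integral_const_mul, integral_add h12345 h6,
    integral_sub h1234 h5, integral_sub h123 h4,
    integral_add h12 h3, integral_add h1 h2]
  simp only [integral_const_mul]
  rw [integral_exp_mul_stdLevyPDF (by positivity), integral_exp_mul_stdLevyPDF (by positivity),
    integral_exp_mul_stdLevyPDF le_rfl, integral_exp_mul_stdLevyPDF (by positivity),
    integral_exp_mul_stdLevyPDF (by positivity), integral_exp_mul_stdLevyPDF hL0.le]
  have hd : √(2 * L) = 2 * √(L / 2) := by
    rw [show 2 * L = 2 ^ 2 * (L / 2) by ring, Real.sqrt_mul (by positivity),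
      Real.sqrt_sq (by norm_num)]
  have h2L : √(2 * (2 * L)) = 2 * √L := by
    rw [show 2 * (2 * L) = 2 ^ 2 * L by ring, Real.sqrt_mul (by positivity),
      Real.sqrt_sq (by norm_num)]
  have hc2 : Real.exp (-(2 * √(L / 2))) = c ^ 2 := by
    rw [hc, ← Real.exp_nat_mul]
    congr 1
    push_cast
    ring
  have hc4 : Real.exp (-(2 * (2 * √(L / 2)))) = c ^ 4 := by
    rw [hc, ← Real.exp_nat_mul]
    congr 1
    push_cast
    ring
  rw [show 2 * (L / 2) = L by ring, h2L, show 2 * (5 * L / 4) = 5 * L / 2 by ring,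
    show 2 * (L / 4) = L / 2 by ring, hd, hc4, sub_eq_add_neg (-(2 * √(L / 2))),
    sub_eq_add_neg (-√(5 * L / 2)), Real.exp_add, Real.exp_add, ← hc, hc2]
  simp only [mul_zero, Real.sqrt_zero, neg_zero, Real.exp_zero]
  ring
end

section
/- Let n ≥ 1, a > 0, and y₁, …, yₙ > 0. Then ∫₀^∞ ((1/n) Σ_{i=1}^n e^{−t y_i} − (1/n²) Σ_{i=1}^n Σ_{j=1}^n e^{−t(y_i+y_j)/4}) · e^{−at} t^{3/2} dt = (3√π/(4n²)) Σ_{i=1}^n Σ_{j=1}^n ( (1/2)(a + y_i)^{−5/2} + (1/2)(a + y_j)^{−5/2} − (a + (y_i+y_j)/4)^{−5/2} ). -/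
open MeasureTheory Set

theorem integrableOn_exp_neg_mul_mul_rpow_three_halves {c : ℝ} (hc : 0 < c) :
    IntegrableOn (fun t : ℝ => Real.exp (-(c * t)) * t ^ ((3:ℝ)/2)) (Ioi 0) := by
  have h := integrableOn_rpow_mul_exp_neg_mul_rpow (s := 3/2) (by norm_num) one_pos hc
  simp only [Real.rpow_one, neg_mul] at h
  simpa only [mul_comm] using h

theorem Real.Gamma_five_halves : Real.Gamma (5/2) = 3 * √Real.pi / 4 := by
  rw [show (5/2 : ℝ) = 1/2 + 1 + 1 by norm_num, Real.Gamma_add_one (by norm_num),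
    Real.Gamma_add_one (by norm_num), Real.Gamma_one_half_eq]
  ring

theorem integral_exp_neg_mul_mul_rpow_three_halves {c : ℝ} (hc : 0 < c) :
    ∫ t in Ioi (0:ℝ), Real.exp (-(c * t)) * t ^ ((3:ℝ)/2)
      = 3 * √Real.pi / 4 * c ^ (-(5:ℝ)/2) := by
  have h := Real.integral_rpow_mul_exp_neg_mul_Ioi (a := 5/2) (by norm_num) hc
  rw [show (5/2 - 1 : ℝ) = 3/2 by norm_num, Real.Gamma_five_halves, one_div,
    Real.inv_rpow hc.le, ← Real.rpow_neg hc.le, ← neg_div] at h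
  simpa only [mul_comm] using h

/-- Closed form of the integral defining the test statistic `R_{n,a}`:
`∫₀^∞ ((1/n) Σᵢ e^{-t yᵢ} - (1/n²) Σᵢ Σⱼ e^{-t(yᵢ+yⱼ)/4}) e^{-at} t^{3/2} dt
  = (3√π/(4n²)) Σᵢ Σⱼ ((1/2)(a+yᵢ)^{-5/2} + (1/2)(a+yⱼ)^{-5/2} - (a+(yᵢ+yⱼ)/4)^{-5/2})`. -/
theorem R_statistic_closed_form (n : ℕ) (hn : 1 ≤ n) (a : ℝ) (ha : 0 < a)
    (y : Fin n → ℝ) (hy : ∀ i, 0 < y i) :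
    (∫ t in Set.Ioi (0:ℝ),
        ((1/(n:ℝ)) * ∑ i, Real.exp (-(t * y i))
          - (1/(n:ℝ)^2) * ∑ i, ∑ j, Real.exp (-(t * (y i + y j) / 4)))
          * Real.exp (-(a * t)) * t ^ ((3:ℝ)/2))
      = (3 * Real.sqrt Real.pi / (4 * (n:ℝ)^2)) *
          ∑ i, ∑ j,
            ((1/2) * (a + y i) ^ (-(5:ℝ)/2) + (1/2) * (a + y j) ^ (-(5:ℝ)/2)
              - (a + (y i + y j)/4) ^ (-(5:ℝ)/2)) := by
  have hn0 : (n : ℝ) ≠ 0 := by positivity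
  have hc₁ (i : Fin n) : 0 < a + y i := add_pos ha (hy i)
  have hc₂ (i j : Fin n) : 0 < a + (y i + y j) / 4 := by
    have := hy i
    have := hy j
    positivity
  have hint₁ (i : Fin n) := integrableOn_exp_neg_mul_mul_rpow_three_halves (hc₁ i)
  have hint₂ (i j : Fin n) := integrableOn_exp_neg_mul_mul_rpow_three_halves (hc₂ i j)
  have hsplit (t : ℝ) :
      ((1/(n:ℝ)) * ∑ i, Real.exp (-(t * y i))
          - (1/(n:ℝ)^2) * ∑ i, ∑ j, Real.exp (-(t * (y i + y j) / 4)))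
          * Real.exp (-(a * t)) * t ^ ((3:ℝ)/2)
        = (1/(n:ℝ)) * ∑ i, Real.exp (-((a + y i) * t)) * t ^ ((3:ℝ)/2)
          - (1/(n:ℝ)^2) * ∑ i, ∑ j,
            Real.exp (-((a + (y i + y j) / 4) * t)) * t ^ ((3:ℝ)/2) := by
    have h₁ (i : Fin n) : Real.exp (-((a + y i) * t))
        = Real.exp (-(t * y i)) * Real.exp (-(a * t)) := by
      rw [← Real.exp_add]
      ring_nf
    have h₂ (i j : Fin n) : Real.exp (-((a + (y i + y j) / 4) * t))
        = Real.exp (-(t * (y i + y j) / 4)) * Real.exp (-(a * t)) := by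
      rw [← Real.exp_add]
      ring_nf
    simp only [h₁, h₂, ← Finset.sum_mul]
    ring
  simp only [hsplit]
  rw [integral_sub
      ((integrable_finsetSum _ fun i _ => hint₁ i).const_mul _)
      ((integrable_finsetSum _ fun i _ => integrable_finsetSum _ fun j _ => hint₂ i j).const_mul _),
    integral_const_mul, integral_const_mul, integral_finsetSum _ fun i _ => hint₁ i,
    integral_finsetSum _ fun i _ => integrable_finsetSum _ fun j _ => hint₂ i j]
  simp only [integral_finsetSum _ fun j _ => hint₂ _ j,
    integral_exp_neg_mul_mul_rpow_three_halves (hc₁ _),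
    integral_exp_neg_mul_mul_rpow_three_halves (hc₂ _ _), Finset.sum_sub_distrib,
    Finset.sum_add_distrib, ← Finset.mul_sum, Finset.sum_const, Finset.card_univ,
    Fintype.card_fin, nsmul_eq_mul]
  field_simp
  ring
end

section
/- Let g be a probability density on (0,∞) such that c := ∫₀^∞ g(x)/x dx ∈ (0,∞), ∫₀^∞ |log g(x)| g(x) dx < ∞, and ∫₀^∞ |log x| g(x) dx < ∞. Then the minimal Kullback–Leibler divergence from g to the Lévy scale family equals inf_{λ>0} ∫₀^∞ log(g(x)/f(x;λ)) g(x) dx = ∫₀^∞ log(g(x)) g(x) dx + log√(2π) + (1/2)·log(∫₀^∞ g(x)/x dx) + 1/2 + (3/2)·∫₀^∞ log(x) g(x) dx. -/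
open MeasureTheory Set

/-- The Kullback–Leibler divergence of the density `g` from the Lévy density with scale `l`. -/
noncomputable def levyKL (g : ℝ → ℝ) (l : ℝ) : ℝ :=
  ∫ x in Set.Ioi (0:ℝ), Real.log (g x / levyPDFpos l x) * g x

/-- The pointwise decomposition of the Kullback–Leibler integrand. -/
theorem log_div_levyPDFpos_mul {l x : ℝ} (hl : 0 < l) (hx : 0 < x) (y : ℝ) :
    Real.log (y / levyPDFpos l x) * y
      = Real.log y * y - (1 / 2) * Real.log (l / (2 * Real.pi)) * y + l / 2 * (y / x)
        + (3 / 2) * (Real.log x * y) := by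
  rcases eq_or_ne y 0 with rfl | hy
  · simp
  have hq : 0 < l / (2 * Real.pi) := by positivity
  have hs : Real.sqrt (l / (2 * Real.pi)) ≠ 0 := (Real.sqrt_pos.2 hq).ne'
  have hp : x ^ (-(3:ℝ)/2) ≠ 0 := (Real.rpow_pos_of_pos hx _).ne'
  have he := Real.exp_ne_zero (-(l / (2 * x)))
  rw [levyPDFpos, Real.log_div hy (mul_ne_zero (mul_ne_zero hs he) hp),
    Real.log_mul (mul_ne_zero hs he) hp, Real.log_mul hs he, Real.log_sqrt hq.le,
    Real.log_exp, Real.log_rpow hx]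
  field_simp
  ring

/-- The Kullback–Leibler divergence from `g` to the Lévy density as a function of the scale. -/
theorem levyKL_eq {g : ℝ → ℝ} (hg1 : (∫ x in Set.Ioi (0:ℝ), g x) = 1)
    (hint1 : IntegrableOn (fun x => g x / x) (Set.Ioi 0))
    (hint2 : IntegrableOn (fun x => Real.log (g x) * g x) (Set.Ioi 0))
    (hint3 : IntegrableOn (fun x => Real.log x * g x) (Set.Ioi 0)) {l : ℝ} (hl : 0 < l) :
    levyKL g l = (∫ x in Set.Ioi (0:ℝ), Real.log (g x) * g x)
      - (1 / 2) * Real.log (l / (2 * Real.pi))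
      + l / 2 * (∫ x in Set.Ioi (0:ℝ), g x / x)
      + (3 / 2) * ∫ x in Set.Ioi (0:ℝ), Real.log x * g x := by
  have hg : IntegrableOn g (Set.Ioi 0) := by
    by_contra h
    exact one_ne_zero (hg1.symm.trans (integral_undef h))
  have hcg := hg.const_mul ((1 / 2) * Real.log (l / (2 * Real.pi)))
  have hc1 := hint1.const_mul (l / 2)
  have hc3 := hint3.const_mul (3 / 2)
  rw [levyKL, setIntegral_congr_fun measurableSet_Ioi
      fun x hx => log_div_levyPDFpos_mul hl hx (g x),
    integral_add (by exact (hint2.sub hcg).add hc1) hc3, integral_add (by exact hint2.sub hcg) hc1,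
    integral_sub hint2 hcg, integral_const_mul, integral_const_mul, integral_const_mul, hg1,
    mul_one]

/-- The minimal Kullback–Leibler divergence from a density `g` on `(0,∞)` to the Lévy scale
family: `inf_{λ>0} K(λ) = ∫ g log g + log √(2π) + (1/2) log (∫ g(x)/x dx) + 1/2
+ (3/2) ∫ g(x) log x dx`. -/
theorem KL_infimum_value (g : ℝ → ℝ)
    (hg0 : ∀ x ∈ Set.Ioi (0:ℝ), 0 ≤ g x)
    (hg1 : (∫ x in Set.Ioi (0:ℝ), g x) = 1)
    (hcpos : 0 < ∫ x in Set.Ioi (0:ℝ), g x / x)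
    (hint1 : IntegrableOn (fun x => g x / x) (Set.Ioi 0))
    (hint2 : IntegrableOn (fun x => Real.log (g x) * g x) (Set.Ioi 0))
    (hint3 : IntegrableOn (fun x => Real.log x * g x) (Set.Ioi 0)) :
    (⨅ l : Set.Ioi (0:ℝ), levyKL g l)
      = (∫ x in Set.Ioi (0:ℝ), Real.log (g x) * g x)
        + Real.log (Real.sqrt (2 * Real.pi))
        + (1/2) * Real.log (∫ x in Set.Ioi (0:ℝ), g x / x)
        + 1/2
        + (3/2) * ∫ x in Set.Ioi (0:ℝ), Real.log x * g x := by
  have hpi : (0:ℝ) < 2 * Real.pi := by positivity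
  have hKL := fun {l : ℝ} => levyKL_eq hg1 hint1 hint2 hint3 (l := l)
  have hbound : ∀ l : Set.Ioi (0:ℝ), levyKL g (∫ x in Set.Ioi (0:ℝ), g x / x)⁻¹ ≤ levyKL g l := by
    rintro ⟨l, hl : 0 < l⟩
    have hlog := Real.log_le_sub_one_of_pos (mul_pos hl hcpos)
    rw [Real.log_mul hl.ne' hcpos.ne'] at hlog
    rw [hKL hl, hKL (inv_pos.2 hcpos), Real.log_div hl.ne' hpi.ne',
      Real.log_div (inv_pos.2 hcpos).ne' hpi.ne', Real.log_inv, div_mul_eq_mul_div (_⁻¹),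
      inv_mul_cancel₀ hcpos.ne']
    linarith
  have hmin : IsLeast (Set.range fun l : Set.Ioi (0:ℝ) => levyKL g l)
      (levyKL g (∫ x in Set.Ioi (0:ℝ), g x / x)⁻¹) :=
    ⟨⟨⟨_, inv_pos.2 hcpos⟩, rfl⟩, Set.forall_mem_range.2 hbound⟩
  rw [iInf, hmin.csInf_eq, hKL (inv_pos.2 hcpos), Real.log_div (inv_pos.2 hcpos).ne' hpi.ne',
    Real.log_inv, div_mul_eq_mul_div (_⁻¹), inv_mul_cancel₀ hcpos.ne', Real.log_sqrt hpi.le]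
  ring
end
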